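/- Let p : M(F_{s+1}) → M(F_s) be the homomorphism induced by x_i ↦ x_i (1 ≤ i ≤ s) and x_{s+1} ↦ 1, and let r : (R(y_1, …, y_s), +) → ker p be the additive map determined on the basis of duplicate-free monomials by r(y_{j_1} ⋯ y_{j_r}) = [x_{j_1}, [x_{j_2}, …, [x_{j_r}, x_{s+1}] … ]] and r(1) = x_{s+1}. Then for every i ∈ {1, …, s} and every Y ∈ R(y_1, …, y_s), one has x_i · r(Y) · x_i⁻¹ = r((1 + y_i) · Y) in M(F_{s+1}); that is, under r, conjugation by x_i corresponds to left ring multiplication by 1 + y_i. -/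

import Mathlib

open scoped commutatorElement

/-- Relators of the Milnor group: `[g i, h⁻¹ * g i * h]` for all `i` and `h`. -/
def milnorRelators {G : Type*} [Group G] {ι : Type*} (g : ι → G) : Set G :=
  {x | ∃ (i : ι) (h : G), x = ⁅g i, h⁻¹ * g i * h⁆}

/-- The Milnor group of `G` with respect to the elements `g i`: the quotient of `G`
by the normal closure of the Milnor relators. -/
abbrev MilnorGroup {G : Type*} [Group G] {ι : Type*} (g : ι → G) : Type _ :=
  G ⧸ Subgroup.normalClosure (milnorRelators g)

/-- The quotient map onto the Milnor group. -/
abbrev milnorQuot {G : Type*} [Group G] {ι : Type*} (g : ι → G) : G →* MilnorGroup g :=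
  QuotientGroup.mk' _

/-- Monomials in the free associative ℤ-algebra on `Fin s` in which some index occurs
at least twice. -/
def dupMonomials (s : ℕ) : Set (FreeAlgebra ℤ (Fin s)) :=
  {x | ∃ l : List (Fin s), ¬ l.Nodup ∧ x = (l.map (FreeAlgebra.ι ℤ)).prod}

/-- The relation whose ring-quotient kills the two-sided ideal generated by the
monomials with a repeated index. -/
def RRel (s : ℕ) : FreeAlgebra ℤ (Fin s) → FreeAlgebra ℤ (Fin s) → Prop :=
  fun a b => a ∈ dupMonomials s ∧ b = 0

/-- Milnor's ring `R(y_1, …, y_s)`. -/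
abbrev RRing (s : ℕ) : Type := RingQuot (RRel s)

/-- The image in `R(y_1, …, y_s)` of the monomial corresponding to a list of indices. -/
def RMonomial {s : ℕ} (l : List (Fin s)) : RRing s :=
  RingQuot.mkRingHom (RRel s) ((l.map (FreeAlgebra.ι ℤ)).prod)

/-- The free Milnor group `M(F_s)`: the Milnor group of the free group on `Fin s`
with respect to its standard generators. -/
abbrev FreeMilnor (s : ℕ) : Type :=
  MilnorGroup (fun i : Fin s => FreeGroup.of i)

/-- The image of the generator `x_i` in the free Milnor group `M(F_s)`. -/
def fmk {s : ℕ} (i : Fin s) : FreeMilnor s :=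
  milnorQuot (fun j : Fin s => FreeGroup.of j) (FreeGroup.of i)

/-- Left-iterated commutator `[f j₁, [f j₂, …, [f jᵣ, base]…]]`; the empty list
gives `base`. -/
def leftIterComm {G : Type*} [Group G] {ι : Type*} (f : ι → G) (base : G) :
    List ι → G
  | [] => base
  | j :: t => ⁅f j, leftIterComm f base t⁆

theorem aux_comm {s : ℕ} (i : Fin s) (c : FreeMilnor s)
    (hc : c ∈ Subgroup.normalClosure {fmk i}) : Commute (fmk i) c := by
  have hle : Subgroup.normalClosure {fmk i} ≤ Subgroup.centralizer {fmk i} := by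
    refine (Subgroup.closure_le _).2 ?_
    intro x hx
    rw [Group.mem_conjugatesOfSet_iff] at hx
    obtain ⟨a, ha, hax⟩ := hx
    rw [Set.mem_singleton_iff] at ha
    subst ha
    obtain ⟨g, rfl⟩ := isConj_iff.1 hax
    obtain ⟨w, rfl⟩ := QuotientGroup.mk'_surjective _ g
    rw [SetLike.mem_coe, Subgroup.mem_centralizer_singleton_iff]
    have h : milnorQuot (fun j : Fin s => FreeGroup.of j)
        ⁅FreeGroup.of i, (w⁻¹)⁻¹ * FreeGroup.of i * w⁻¹⁆ = 1 :=
      (QuotientGroup.eq_one_iff _).2 (Subgroup.subset_normalClosure ⟨i, w⁻¹, rfl⟩)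
    rw [map_commutatorElement, commutatorElement_eq_one_iff_mul_comm] at h
    simp only [map_mul, map_inv, inv_inv] at h
    first
      | exact h
      | exact h.symm
  have := hle hc
  rw [Subgroup.mem_centralizer_singleton_iff] at this
  first
    | exact this
    | exact this.symm

theorem aux_mem {G ι : Type*} [Group G] (f : ι → G) (b : G) (i : ι) :
    ∀ l : List ι, i ∈ l → leftIterComm f b l ∈ Subgroup.normalClosure {f i}
  | [], h => by simp at h
  | j :: t, h => by
    have hn : (Subgroup.normalClosure {f i}).Normal := inferInstance
    rw [leftIterComm, commutatorElement_def]
    rcases List.mem_cons.1 h with rfl | h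
    · have h1 : f i ∈ Subgroup.normalClosure {f i} := Subgroup.subset_normalClosure rfl
      rw [mul_assoc, mul_assoc, ← mul_assoc (leftIterComm f b t)]
      exact mul_mem h1 (hn.conj_mem _ (inv_mem h1) _)
    · have h1 := aux_mem f b i t h
      exact mul_mem (hn.conj_mem _ h1 _) (inv_mem h1)

theorem aux_span {s : ℕ} (Y : RRing s) :
    Y ∈ AddSubgroup.closure (Set.range (RMonomial (s := s))) := by
  obtain ⟨a, rfl⟩ := RingQuot.mkRingHom_surjective (RRel s) Y
  have key : ∀ a : FreeAlgebra ℤ (Fin s), a ∈ AddSubgroup.closure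
      (Set.range fun l : List (Fin s) => (l.map (FreeAlgebra.ι ℤ)).prod) := by
    intro a
    induction a using FreeAlgebra.induction with
    | grade0 n =>
      have := AddSubgroup.zsmul_mem _ (AddSubgroup.subset_closure (k := Set.range
        fun l : List (Fin s) => (l.map (FreeAlgebra.ι ℤ)).prod) ⟨[], rfl⟩) n
      simpa [Algebra.algebraMap_eq_smul_one] using this
    | grade1 x => exact AddSubgroup.subset_closure ⟨[x], by simp⟩
    | add a b ha hb => exact add_mem ha hb
    | mul a b ha hb =>
      induction ha using AddSubgroup.closure_induction with
      | zero => simp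
      | add x y _ _ hx hy => rw [add_mul]; exact add_mem hx hy
      | neg x _ hx => rw [neg_mul]; exact neg_mem hx
      | mem x hx =>
        obtain ⟨l, rfl⟩ := hx
        induction hb using AddSubgroup.closure_induction with
        | zero => simp
        | add x y _ _ hx hy => rw [mul_add]; exact add_mem hx hy
        | neg x _ hx => rw [mul_neg]; exact neg_mem hx
        | mem x hx =>
          obtain ⟨m, rfl⟩ := hx
          exact AddSubgroup.subset_closure ⟨l ++ m, by simp⟩
  induction key a using AddSubgroup.closure_induction with
  | zero => simp
  | add x y _ _ hx hy => rw [map_add]; exact add_mem hx hy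
  | neg x _ hx => rw [map_neg]; exact neg_mem hx
  | mem x hx =>
    obtain ⟨l, rfl⟩ := hx
    exact AddSubgroup.subset_closure ⟨l, rfl⟩

theorem aux_dup {s : ℕ} (l : List (Fin s)) (h : ¬ l.Nodup) : RMonomial l = 0 := by
  rw [RMonomial, ← map_zero (RingQuot.mkRingHom (RRel s))]
  exact RingQuot.mkRingHom_rel ⟨⟨l, h, rfl⟩, rfl⟩

theorem aux_cons {s : ℕ} (i : Fin s) (l : List (Fin s)) :
    RMonomial [i] * RMonomial l = RMonomial (i :: l) := by
  simp [RMonomial]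

/-- Under the map `r : (R(y_1, …, y_s), +) → M(F_{s+1})` sending duplicate-free
monomials to left-iterated commutators (and `1` to `x_{s+1}`), conjugation by `x_i`
corresponds to left ring multiplication by `1 + y_i`:
`x_i · r(Y) · x_i⁻¹ = r((1 + y_i) · Y)`. -/
theorem milnor_conjugation_action (s : ℕ) (r : RRing s → FreeMilnor (s + 1))
    (hadd : ∀ Y Z : RRing s, r (Y + Z) = r Y * r Z)
    (hmon : ∀ l : List (Fin s), l.Nodup →
      r (RMonomial l) =
        leftIterComm (fun i : Fin s => fmk i.castSucc) (fmk (Fin.last s)) l) :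
    ∀ (i : Fin s) (Y : RRing s),
      fmk i.castSucc * r Y * (fmk i.castSucc)⁻¹ = r ((1 + RMonomial [i]) * Y) := by
  intro i Y
  have h0 : r 0 = 1 := by
    have := hadd 0 0
    rw [add_zero] at this
    exact left_eq_mul.1 this
  have hneg : ∀ Z W, W + Z = 0 → r W = (r Z)⁻¹ := by
    intro Z W h
    rw [eq_inv_iff_mul_eq_one, ← hadd, h, h0]
  induction aux_span Y using AddSubgroup.closure_induction with
  | zero => simp [h0]
  | add x y _ _ hx hy =>
    rw [mul_add, hadd, hadd, ← hx, ← hy]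
    group
  | neg x _ hx =>
    have h1 : -x + x = 0 := neg_add_cancel x
    rw [hneg _ _ h1, hneg ((1 + RMonomial [i]) * x) ((1 + RMonomial [i]) * -x) (by rw [← mul_add, h1, mul_zero]), ← hx]
    group
  | mem x hx =>
    obtain ⟨l, rfl⟩ := hx
    by_cases hl : l.Nodup
    · rw [add_mul, one_mul, aux_cons, add_comm (RMonomial l), hadd]
      by_cases hi : i ∈ l
      · rw [aux_dup (i :: l) (by simp [hi]), h0, one_mul, hmon l hl]
        have := aux_comm i.castSucc _
          (aux_mem (fun i : Fin s => fmk i.castSucc) (fmk (Fin.last s)) i l hi)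
        rw [this.eq, mul_inv_cancel_right]
      · rw [hmon l hl, hmon (i :: l) (List.nodup_cons.2 ⟨hi, hl⟩), leftIterComm,
          commutatorElement_def, inv_mul_cancel_right]
    · rw [aux_dup l hl, mul_zero, h0]
      simp
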